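/- arXiv:math/0006176 — 2 statements merged into one kernel-verified Lean document; each statement's English description precedes it below -/
import Mathlib

section
/- For every τ in the upper half plane ℍ, the genus-one thetanulls satisfy θ_{00}(τ)⁴ = 4(ψ_{10}(τ) − ψ_{01}(τ)), θ_{01}(τ)⁴ = 4(ψ_{10}(τ) − ψ_{00}(τ)), and θ_{10}(τ)⁴ = 4(ψ_{00}(τ) − ψ_{01}(τ)). -/
open Complex BigOperators

noncomputable section

/-- The genus-one thetanull `θ₀₀(τ) = ∑ₙ exp(πi n² τ)`. -/
def theta00 (τ : ℂ) : ℂ :=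
  ∑' n : ℤ, Complex.exp ((Real.pi : ℂ) * Complex.I * (n : ℂ) ^ 2 * τ)

/-- The genus-one thetanull `θ₀₁(τ) = ∑ₙ (−1)ⁿ exp(πi n² τ)`. -/
def theta01 (τ : ℂ) : ℂ :=
  ∑' n : ℤ, (-1 : ℂ) ^ n * Complex.exp ((Real.pi : ℂ) * Complex.I * (n : ℂ) ^ 2 * τ)

/-- The genus-one thetanull `θ₁₀(τ) = ∑ₙ exp(πi (n+1/2)² τ)`. -/
def theta10 (τ : ℂ) : ℂ :=
  ∑' n : ℤ, Complex.exp ((Real.pi : ℂ) * Complex.I * ((n : ℂ) + 1 / 2) ^ 2 * τ)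

/-- The logarithmic derivative `ψ_f = (1/πi) f′/f`. -/
def psiLog (f : ℂ → ℂ) (τ : ℂ) : ℂ :=
  1 / ((Real.pi : ℂ) * Complex.I) * (deriv f τ / f τ)

/-! ### Basic theta identities -/

lemma theta00_eq (τ : ℂ) : theta00 τ = jacobiTheta₂ 0 τ := by
  unfold theta00 jacobiTheta₂ jacobiTheta₂_term
  exact tsum_congr fun n => by congr 1; ring

lemma exp_pi_I_int (n : ℤ) : Complex.exp ((Real.pi : ℂ) * Complex.I * n) = (-1 : ℂ) ^ n := by
  rw [mul_comm, Complex.exp_int_mul, Complex.exp_pi_mul_I]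

lemma theta01_eq (τ : ℂ) : theta01 τ = jacobiTheta₂ (1 / 2) τ := by
  unfold theta01 jacobiTheta₂ jacobiTheta₂_term
  refine tsum_congr fun n => ?_
  rw [Complex.exp_add, ← exp_pi_I_int]
  congr 2; ring

lemma theta10_eq (τ : ℂ) :
    theta10 τ = Complex.exp ((Real.pi : ℂ) * Complex.I * τ / 4) * jacobiTheta₂ (τ / 2) τ := by
  unfold theta10 jacobiTheta₂ jacobiTheta₂_term
  rw [← tsum_mul_left]
  refine tsum_congr fun n => ?_
  rw [← Complex.exp_add]
  congr 1; ring

lemma exp_pi_I_sq (n : ℤ) :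
    Complex.exp ((Real.pi : ℂ) * Complex.I * (n : ℂ) ^ 2) = (-1 : ℂ) ^ n := by
  have := exp_pi_I_int (n ^ 2)
  push_cast at this
  rw [this]
  rcases Int.even_or_odd n with h | h
  · rw [h.neg_one_zpow, (h.pow_of_ne_zero two_ne_zero).neg_one_zpow]
  · rw [h.neg_one_zpow, (h.pow).neg_one_zpow]

lemma theta00_T (τ : ℂ) : theta00 (τ + 1) = theta01 τ := by
  unfold theta00 theta01
  refine tsum_congr fun n => ?_
  rw [← exp_pi_I_sq, ← Complex.exp_add]
  congr 1; ring

lemma theta01_T (τ : ℂ) : theta01 (τ + 1) = theta00 τ := by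
  unfold theta00 theta01
  refine tsum_congr fun n => ?_
  rw [mul_add, Complex.exp_add, mul_one, exp_pi_I_sq, mul_left_comm, ← mul_zpow]
  simp

lemma theta10_T (τ : ℂ) :
    theta10 (τ + 1) = Complex.exp ((Real.pi : ℂ) * Complex.I / 4) * theta10 τ := by
  unfold theta10
  rw [← tsum_mul_left]
  refine tsum_congr fun n => ?_
  rw [mul_add, Complex.exp_add, mul_one, mul_comm]
  congr 1
  rw [show (Real.pi : ℂ) * Complex.I * ((n : ℂ) + 1 / 2) ^ 2 =
    (Real.pi : ℂ) * Complex.I * (n : ℂ) ^ 2 + ((Real.pi : ℂ) * Complex.I * n +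
      (Real.pi : ℂ) * Complex.I / 4) by ring, Complex.exp_add, Complex.exp_add, exp_pi_I_sq,
      exp_pi_I_int, ← mul_assoc, ← mul_zpow]
  simp

/-- The automorphy factor. -/
def sfac (τ : ℂ) : ℂ := (-Complex.I * τ) ^ (1 / 2 : ℂ)

lemma ne_zero_of_im {τ : ℂ} (hτ : 0 < τ.im) : τ ≠ 0 := by
  rintro rfl; simp at hτ

lemma im_S {τ : ℂ} (hτ : 0 < τ.im) : 0 < (-1 / τ).im := by
  have h := Complex.normSq_pos.mpr (ne_zero_of_im hτ)
  rw [neg_div, one_div, Complex.neg_im, Complex.inv_im, neg_div, neg_neg]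
  positivity

lemma sfac_sq {τ : ℂ} : sfac τ ^ 2 = -Complex.I * τ := by
  unfold sfac
  rw [one_div]
  exact_mod_cast Complex.cpow_nat_inv_pow (-Complex.I * τ) two_ne_zero

lemma sfac_pow4 (τ : ℂ) : sfac τ ^ 4 = -τ ^ 2 := by
  rw [show sfac τ ^ 4 = (sfac τ ^ 2) ^ 2 by ring, sfac_sq, mul_pow]
  simp

lemma sfac_ne {τ : ℂ} (hτ : 0 < τ.im) : sfac τ ≠ 0 := by
  intro h
  have := sfac_sq (τ := τ)
  rw [h] at this
  simp [ne_zero_of_im hτ] at this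

lemma theta00_S {τ : ℂ} (hτ : 0 < τ.im) : theta00 (-1 / τ) = sfac τ * theta00 τ := by
  have h := jacobiTheta₂_functional_equation 0 τ
  have hs := sfac_ne hτ
  rw [theta00_eq, theta00_eq, h]
  change _ = sfac τ * (1 / sfac τ * _ * _)
  simp; field_simp

lemma theta10_S {τ : ℂ} (hτ : 0 < τ.im) : theta10 (-1 / τ) = sfac τ * theta01 τ := by
  have h := jacobiTheta₂_functional_equation (1 / 2) τ
  have hs := sfac_ne hτ
  have h0 := ne_zero_of_im hτ
  rw [theta10_eq, theta01_eq, h]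
  change _ = sfac τ * (1 / sfac τ * _ * _)
  rw [← jacobiTheta₂_neg_left (-1 / τ / 2), show -(-1 / τ / 2) = 1 / 2 / τ by field_simp,
    show (Real.pi : ℂ) * Complex.I * (-1 / τ) / 4 = -Real.pi * Complex.I * (1 / 2) ^ 2 / τ by
      field_simp; norm_num]
  field_simp

lemma theta01_S {τ : ℂ} (hτ : 0 < τ.im) : theta01 (-1 / τ) = sfac τ * theta10 τ := by
  have h := jacobiTheta₂_functional_equation (τ / 2) τ
  have hs := sfac_ne hτ
  have h0 := ne_zero_of_im hτ
  rw [theta10_eq, theta01_eq, h]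
  change _ = sfac τ * (_ * (1 / sfac τ * _ * _))
  rw [show τ / 2 / τ = 1 / 2 by field_simp,
    show -(Real.pi : ℂ) * Complex.I * (τ / 2) ^ 2 / τ = -(Real.pi * Complex.I * τ / 4) by
      field_simp; norm_num, Complex.exp_neg]
  have := Complex.exp_ne_zero (Real.pi * Complex.I * τ / 4)
  field_simp

/-! ### Differentiability -/

/-- `θ₁₀` with the leading exponential removed. -/
def thetaD (τ : ℂ) : ℂ := jacobiTheta₂ (τ / 2) τ

lemma diff_theta00 {τ : ℂ} (hτ : 0 < τ.im) : DifferentiableAt ℂ theta00 τ := by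
  rw [funext theta00_eq]
  exact differentiableAt_jacobiTheta₂_snd 0 hτ

lemma diff_theta01 {τ : ℂ} (hτ : 0 < τ.im) : DifferentiableAt ℂ theta01 τ := by
  rw [funext theta01_eq]
  exact differentiableAt_jacobiTheta₂_snd _ hτ

lemma diff_thetaD {τ : ℂ} (hτ : 0 < τ.im) : DifferentiableAt ℂ thetaD τ := by
  have h := (hasFDerivAt_jacobiTheta₂ (τ / 2) hτ).differentiableAt
  have h2 : DifferentiableAt ℂ (fun t : ℂ => (t / 2, t)) τ := by fun_prop
  exact DifferentiableAt.comp (f := fun t : ℂ => (t / 2, t)) τ h h2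

lemma theta10_eq_D :
    theta10 = fun τ => Complex.exp ((Real.pi : ℂ) * Complex.I * τ / 4) * thetaD τ :=
  funext theta10_eq

lemma diff_theta10 {τ : ℂ} (hτ : 0 < τ.im) : DifferentiableAt ℂ theta10 τ := by
  rw [theta10_eq_D]
  have := diff_thetaD hτ
  fun_prop

/-! ### Level one, weight twelve -/

open UpperHalfPlane ModularForm MatrixGroups in
lemma level_one_twelve (F : ℂ → ℂ) (hd : ∀ τ : ℂ, 0 < τ.im → DifferentiableAt ℂ F τ)
    (hT : ∀ τ : ℂ, 0 < τ.im → F (τ + 1) = F τ)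
    (hS : ∀ τ : ℂ, 0 < τ.im → F (-1 / τ) = τ ^ 12 * F τ)
    (h0 : Filter.Tendsto (fun τ : ℍ => F τ) atImInfty (nhds 0)) :
    ∃ c : ℂ, ∀ τ : ℍ, F τ = c * discriminant τ := by
  let f : ℍ → ℂ := fun τ => F τ
  have hfT : f ∣[(12 : ℤ)] ModularGroup.T = f := by
    ext z
    rw [SL_slash_apply, modular_T_smul]
    have hden : denom ModularGroup.T z = 1 := by
      rw [ModularGroup.denom_apply]; simp [ModularGroup.coe_T]
    have := hT z z.2
    rw [hden, one_zpow, mul_one]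
    simp only [f, coe_vadd, Complex.ofReal_one]
    rw [add_comm]
    exact this
  have hfS : f ∣[(12 : ℤ)] ModularGroup.S = f := by
    ext z
    have := hS z z.2
    have hz := z.ne_zero
    rw [SL_slash_apply, UpperHalfPlane.modular_S_smul]
    rw [ModularGroup.denom_S]
    have e : F ((-(z : ℂ))⁻¹) = (z : ℂ) ^ 12 * F z := by
      rw [← this]; congr 1; field_simp
    change F ((-(z : ℂ))⁻¹) * (z : ℂ) ^ (-12 : ℤ) = F z
    rw [e, zpow_neg]
    have : (z : ℂ) ^ (12 : ℤ) = (z : ℂ) ^ 12 := by norm_cast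
    rw [this]
    field_simp
  have hinv := SlashInvariantForm.slash_action_generators_SL2Z hfS hfT
  let g : CuspForm 𝒮ℒ 12 :=
    { toFun := f
      slash_action_eq' := by
        rintro _ ⟨γ, rfl⟩
        exact hinv γ
      holo' := by
        rw [UpperHalfPlane.mdifferentiable_iff]
        intro z hz
        have := (hd z hz).differentiableWithinAt (s := {z | 0 < z.im})
        refine this.congr (fun y hy => ?_) ?_
        · simp [f, ofComplex_apply_of_im_pos hy]
        · simp [f, ofComplex_apply_of_im_pos hz]
      zero_at_cusps' := by
        intro c hc
        rw [Subgroup.IsArithmetic.isCusp_iff_isCusp_SL2Z] at hc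
        rw [OnePoint.isZeroAt_iff_forall_SL2Z hc]
        intro γ _
        rw [hinv γ]
        exact h0 }
  obtain ⟨c, hc⟩ := CuspForm.exists_smul_discriminant_of_weight_eq_twelve g
  refine ⟨c, fun τ => ?_⟩
  have := congrArg (fun u : CuspForm 𝒮ℒ 12 => u τ) hc
  exact this.symm

/-! ### Asymptotics at infinity -/

/-- The filter `Im τ → ∞`. -/
def imInf : Filter ℂ := Filter.comap Complex.im Filter.atTop

/-- The comparison function `|exp (π i τ)|`. -/
def expE (τ : ℂ) : ℝ := Real.exp (-Real.pi * τ.im)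

lemma imInf_ge (A : ℝ) : ∀ᶠ τ : ℂ in imInf, A ≤ τ.im :=
  Filter.tendsto_comap.eventually (Filter.eventually_ge_atTop A)

lemma tendsto_expE : Filter.Tendsto expE imInf (nhds 0) := by
  have h : Filter.Tendsto (fun y : ℝ => Real.exp (-Real.pi * y)) Filter.atTop (nhds 0) := by
    refine Real.tendsto_exp_atBot.comp ?_
    exact Filter.tendsto_id.const_mul_atTop_of_neg (neg_lt_zero.mpr Real.pi_pos)
  exact h.comp Filter.tendsto_comap

lemma isBigO_of_bound {g : ℂ → ℂ} (C A : ℝ) (h : ∀ τ : ℂ, A ≤ τ.im → ‖g τ‖ ≤ C * expE τ) :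
    g =O[imInf] expE := by
  refine Asymptotics.IsBigO.of_bound C ?_
  filter_upwards [imInf_ge A] with τ hτ
  rw [Real.norm_of_nonneg (show 0 ≤ expE τ from (Real.exp_pos _).le)]
  exact h τ hτ

lemma bound_of_isBigO {g : ℂ → ℂ} (h : g =O[imInf] expE) :
    ∃ C A : ℝ, ∀ τ : ℂ, A ≤ τ.im → ‖g τ‖ ≤ C * expE τ := by
  obtain ⟨C, hC⟩ := h.bound
  unfold imInf at hC
  rw [Filter.eventually_comap, Filter.eventually_atTop] at hC
  obtain ⟨A, hA⟩ := hC
  refine ⟨C, A, fun τ hτ => ?_⟩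
  have := hA τ.im hτ τ rfl
  rwa [Real.norm_of_nonneg (show 0 ≤ expE τ from (Real.exp_pos _).le)] at this

lemma isBigO_deriv {g : ℂ → ℂ} (hd : ∀ τ : ℂ, 0 < τ.im → DifferentiableAt ℂ g τ)
    (h : g =O[imInf] expE) : deriv g =O[imInf] expE := by
  obtain ⟨C, A, hC⟩ := bound_of_isBigO h
  have key : ∀ τ z : ℂ, z ∈ Metric.closedBall τ 1 → τ.im - 1 ≤ z.im := by
    intro τ z hz
    have h1 : ‖z - τ‖ ≤ 1 := by simpa [dist_eq_norm] using hz
    have h2 := Complex.abs_im_le_norm (z - τ)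
    have h3 := (abs_le.mp (h2.trans h1)).1
    rw [Complex.sub_im] at h3
    linarith
  refine isBigO_of_bound (|C| * Real.exp Real.pi) (max (A + 1) 2) fun τ hτ => ?_
  have hA : A + 1 ≤ τ.im := (le_max_left _ _).trans hτ
  have h2 : 2 ≤ τ.im := (le_max_right _ _).trans hτ
  have hdc : DiffContOnCl ℂ g (Metric.ball τ 1) := by
    refine DifferentiableOn.diffContOnCl ?_
    rw [closure_ball τ one_ne_zero]
    intro z hz
    exact (hd z (by linarith [key τ z hz])).differentiableWithinAt
  have := Complex.norm_deriv_le_of_forall_mem_sphere_norm_le (C := |C| * Real.exp Real.pi * expE τ)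
    one_pos hdc ?_
  · simpa using this
  · intro z hz
    have hz' := key τ z (Metric.sphere_subset_closedBall hz)
    refine (hC z (by linarith)).trans ?_
    rw [mul_assoc]
    have h5 : expE z ≤ Real.exp Real.pi * expE τ := by
      unfold expE
      rw [← Real.exp_add, Real.exp_le_exp]
      nlinarith [Real.pi_pos]
    calc C * expE z ≤ |C| * expE z :=
          mul_le_mul_of_nonneg_right (le_abs_self C) (Real.exp_pos _).le
      _ ≤ _ := mul_le_mul_of_nonneg_left h5 (abs_nonneg C)

lemma theta00_asymp : (fun τ => theta00 τ - 1) =O[imInf] expE := by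
  have h := isBigO_at_im_infty_jacobiTheta_sub_one
  have e : theta00 = jacobiTheta := funext fun τ => by
    rw [theta00_eq, jacobiTheta_eq_jacobiTheta₂]
  rw [e]
  exact h

lemma theta01_asymp : (fun τ => theta01 τ - 1) =O[imInf] expE := by
  obtain ⟨C, A, h⟩ := bound_of_isBigO theta00_asymp
  refine isBigO_of_bound C A fun τ hτ => ?_
  have := h (τ + 1) (by simpa using hτ)
  rw [theta00_T] at this
  simpa [expE] using this

lemma thetaD_asymp : (fun τ => thetaD τ - 2) =O[imInf] expE := by
  let B : ℤ → ℝ := fun n => ‖jacobiTheta₂_term n (Complex.I / 2) Complex.I‖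
  have hB : Summable B := ((summable_jacobiTheta₂_term_iff (Complex.I / 2) Complex.I).mpr
    (by simp)).norm
  refine isBigO_of_bound (Real.exp Real.pi * ∑' n, B n) 1 fun τ hτ => ?_
  have hτ0 : 0 < τ.im := by linarith
  have h1 := hasSum_jacobiTheta₂_term (τ / 2) hτ0
  have h2 : HasSum (fun n : ℤ => if n = 0 ∨ n = -1 then (1 : ℂ) else 0) 2 := by
    have : HasSum (fun n : ℤ => if n = 0 ∨ n = -1 then (1 : ℂ) else 0)
        (∑ n ∈ ({0, -1} : Finset ℤ), if n = 0 ∨ n = -1 then (1 : ℂ) else 0) :=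
      hasSum_sum_of_ne_finset_zero (fun n hn => by simp at hn; simp [hn])
    convert this using 1
    rw [Finset.sum_pair (by norm_num)]
    norm_num
  have h3 := h1.sub h2
  change HasSum _ (thetaD τ - 2) at h3
  have h4 : HasSum (fun n => Real.exp Real.pi * expE τ * B n)
      (Real.exp Real.pi * expE τ * ∑' n, B n) := hB.hasSum.mul_left _
  rw [mul_right_comm, ← h3.tsum_eq]
  refine tsum_of_norm_bounded h4 fun n => ?_
  have him : (τ / 2).im = τ.im / 2 := by
    rw [show (2 : ℂ) = ((2 : ℝ) : ℂ) by norm_num, Complex.div_ofReal_im]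
  have him2 : (Complex.I / 2).im = 1 / 2 := by
    rw [show (2 : ℂ) = ((2 : ℝ) : ℂ) by norm_num, Complex.div_ofReal_im, Complex.I_im]
  split_ifs with hn
  · have : jacobiTheta₂_term n (τ / 2) τ = 1 := by
      unfold jacobiTheta₂_term
      rw [Complex.exp_eq_one_iff]
      refine ⟨0, ?_⟩
      rcases hn with rfl | rfl <;> push_cast <;> ring
    rw [this, sub_self, norm_zero]
    exact mul_nonneg (mul_nonneg (Real.exp_pos _).le (Real.exp_pos _).le) (norm_nonneg _)
  · rw [sub_zero]
    simp only [B, expE]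
    rw [norm_jacobiTheta₂_term, norm_jacobiTheta₂_term, ← Real.exp_add, ← Real.exp_add,
      Real.exp_le_exp, him, him2, Complex.I_im]
    have hm : (1 : ℝ) ≤ (n : ℝ) ^ 2 + n := by
      have : 1 ≤ n ^ 2 + n := by
        push Not at hn
        have h : 0 < n ∨ n < -1 := by omega
        rcases h with h | h <;> nlinarith
      exact_mod_cast this
    have := mul_nonneg (mul_nonneg (sub_nonneg.mpr hm) (sub_nonneg.mpr hτ)) Real.pi_pos.le
    nlinarith

lemma tendsto_of_asymp {g : ℂ → ℂ} {c : ℂ} (h : (fun τ => g τ - c) =O[imInf] expE) :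
    Filter.Tendsto g imInf (nhds c) := by
  have := (h.trans_tendsto tendsto_expE).add_const c
  simpa using this

lemma logDeriv_asymp {g : ℂ → ℂ} {c : ℂ} (hc : c ≠ 0)
    (hd : ∀ τ : ℂ, 0 < τ.im → DifferentiableAt ℂ g τ)
    (h : (fun τ => g τ - c) =O[imInf] expE) : (fun τ => deriv g τ / g τ) =O[imInf] expE := by
  have h1 : deriv g =O[imInf] expE := by
    have := isBigO_deriv (fun τ hτ => (hd τ hτ).sub_const c) h
    simpa using this
  have h2 : (fun τ => (g τ)⁻¹) =O[imInf] (fun _ => (1 : ℝ)) :=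
    ((tendsto_of_asymp h).inv₀ hc).isBigO_one ℝ
  have := h1.mul h2
  simpa [div_eq_mul_inv] using this

lemma pow4_asymp {g : ℂ → ℂ} (h : (fun τ => g τ - 1) =O[imInf] expE) :
    (fun τ => g τ ^ 4 - 1) =O[imInf] expE := by
  have ht := tendsto_of_asymp h
  have h2 : (fun τ => g τ ^ 3 + g τ ^ 2 + g τ + 1) =O[imInf] (fun _ => (1 : ℝ)) :=
    ((((ht.pow 3).add (ht.pow 2)).add ht).add_const 1).isBigO_one ℝ
  have := h.mul h2
  simp only [mul_one] at this
  refine this.congr_left fun τ => by ring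

lemma norm_exp_pi (τ : ℂ) : ‖Complex.exp ((Real.pi : ℂ) * Complex.I * τ)‖ = expE τ := by
  rw [Complex.norm_exp, expE]
  congr 1
  simp

lemma theta10_pow4_eq (τ : ℂ) :
    theta10 τ ^ 4 = Complex.exp ((Real.pi : ℂ) * Complex.I * τ) * thetaD τ ^ 4 := by
  rw [theta10_eq_D, mul_pow, ← Complex.exp_nat_mul]
  congr 2
  push_cast; ring

lemma theta10_pow4_asymp : (fun τ => theta10 τ ^ 4) =O[imInf] expE := by
  have h1 : (fun τ => Complex.exp ((Real.pi : ℂ) * Complex.I * τ)) =O[imInf] expE :=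
    Asymptotics.IsBigO.of_bound 1 (Filter.Eventually.of_forall fun τ => by
      rw [norm_exp_pi, one_mul]; exact le_abs_self _)
  have h2 := ((tendsto_of_asymp thetaD_asymp).pow 4).isBigO_one ℝ
  have := h1.mul h2
  simp only [mul_one] at this
  exact this.congr_left fun τ => (theta10_pow4_eq τ).symm

lemma tendsto_coe_imInf :
    Filter.Tendsto (fun τ : UpperHalfPlane => (τ : ℂ)) UpperHalfPlane.atImInfty imInf := by
  unfold imInf
  rw [Filter.tendsto_comap_iff]
  exact Filter.tendsto_comap

/-! ### Nonvanishing -/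

lemma theta_prod_ne {τ : ℂ} (hτ : 0 < τ.im) : theta00 τ * theta01 τ * theta10 τ ≠ 0 := by
  let F : ℂ → ℂ := fun τ => (theta00 τ * theta01 τ * theta10 τ) ^ 8
  have ha := tendsto_of_asymp theta00_asymp
  have hb := tendsto_of_asymp theta01_asymp
  have hD := tendsto_of_asymp thetaD_asymp
  have h10 : Filter.Tendsto (fun τ => theta10 τ ^ 4) imInf (nhds 0) :=
    theta10_pow4_asymp.trans_tendsto tendsto_expE
  have hF0 : Filter.Tendsto F imInf (nhds 0) := by
    have := ((ha.pow 8).mul (hb.pow 8)).mul (h10.pow 2)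
    simp only [one_pow, mul_one, ne_eq, OfNat.ofNat_ne_zero, not_false_eq_true, zero_pow,
      mul_zero] at this
    refine this.congr fun τ => ?_
    simp only [F]; ring
  obtain ⟨c, hc⟩ := level_one_twelve F
    (fun τ hτ => (((diff_theta00 hτ).mul (diff_theta01 hτ)).mul (diff_theta10 hτ)).pow 8)
    (fun τ hτ => by
      have e8 : Complex.exp ((Real.pi : ℂ) * Complex.I / 4) ^ 8 = 1 := by
        rw [← Complex.exp_nat_mul, Complex.exp_eq_one_iff]
        exact ⟨1, by push_cast; ring⟩
      simp only [F]
      rw [theta00_T, theta01_T, theta10_T, show (theta01 τ * theta00 τ *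
        (Complex.exp ((Real.pi : ℂ) * Complex.I / 4) * theta10 τ)) ^ 8 =
        Complex.exp ((Real.pi : ℂ) * Complex.I / 4) ^ 8 * (theta00 τ * theta01 τ * theta10 τ) ^ 8
        by ring, e8, one_mul])
    (fun τ hτ => by
      simp only [F]
      rw [theta00_S hτ, theta01_S hτ, theta10_S hτ, show (sfac τ * theta00 τ * (sfac τ * theta10 τ)
        * (sfac τ * theta01 τ)) ^ 8 = (sfac τ ^ 4) ^ 6 * (theta00 τ * theta01 τ * theta10 τ) ^ 8
        by ring, sfac_pow4]
      ring)
    (hF0.comp tendsto_coe_imInf)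
  have hev : ∀ᶠ τ : ℂ in imInf, F τ ≠ 0 := by
    filter_upwards [ha.eventually_ne one_ne_zero, hb.eventually_ne one_ne_zero,
      hD.eventually_ne two_ne_zero] with t h1 h2 h3
    have : theta10 t ≠ 0 := by
      rw [theta10_eq_D]
      exact mul_ne_zero (Complex.exp_ne_zero _) h3
    exact pow_ne_zero _ (mul_ne_zero (mul_ne_zero h1 h2) this)
  obtain ⟨t, ht⟩ := (tendsto_coe_imInf.eventually hev).exists
  have hc0 : c ≠ 0 := by
    rintro rfl
    exact ht (by rw [hc t, zero_mul])
  have h := hc ⟨τ, hτ⟩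
  have hne : F τ ≠ 0 := by
    have : F τ = c * ModularForm.discriminant ⟨τ, hτ⟩ := h
    rw [this]
    exact mul_ne_zero hc0 (ModularForm.discriminant_ne_zero _)
  intro h0
  exact hne (by simp only [F, h0]; norm_num)

lemma theta00_ne {τ : ℂ} (hτ : 0 < τ.im) : theta00 τ ≠ 0 := fun h =>
  theta_prod_ne hτ (by rw [h]; ring)

lemma theta01_ne {τ : ℂ} (hτ : 0 < τ.im) : theta01 τ ≠ 0 := fun h =>
  theta_prod_ne hτ (by rw [h]; ring)

lemma theta10_ne {τ : ℂ} (hτ : 0 < τ.im) : theta10 τ ≠ 0 := fun h =>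
  theta_prod_ne hτ (by rw [h]; ring)

/-! ### Transformation of logarithmic derivatives -/

lemma psiLog_T {f g : ℂ → ℂ} {c : ℂ} (hc : c ≠ 0) (h : ∀ τ, f (τ + 1) = c * g τ) (τ : ℂ) :
    psiLog f (τ + 1) = psiLog g τ := by
  unfold psiLog
  have h1 : deriv f (τ + 1) = c * deriv g τ := by
    rw [← deriv_comp_add_const f 1 τ, funext h, deriv_const_mul_field]
  rw [h1, h, mul_div_mul_left _ _ hc]

lemma diff_sfac {τ : ℂ} (hτ : 0 < τ.im) : DifferentiableAt ℂ sfac τ := by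
  unfold sfac
  refine DifferentiableAt.cpow_const (by fun_prop) ?_
  left
  simpa using hτ

lemma psiLog_S {f g : ℂ → ℂ} (h : ∀ τ : ℂ, 0 < τ.im → f (-1 / τ) = sfac τ * g τ)
    (hf : ∀ τ : ℂ, 0 < τ.im → DifferentiableAt ℂ f τ)
    (hg : ∀ τ : ℂ, 0 < τ.im → DifferentiableAt ℂ g τ)
    (hg0 : ∀ τ : ℂ, 0 < τ.im → g τ ≠ 0) {τ : ℂ} (hτ : 0 < τ.im) :
    psiLog f (-1 / τ) = τ ^ 2 * (psiLog sfac τ + psiLog g τ) := by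
  have h0 := ne_zero_of_im hτ
  have hs := sfac_ne hτ
  have hgτ := hg0 τ hτ
  have hev : (fun t => f (-1 / t)) =ᶠ[nhds τ] fun t => sfac t * g t := by
    have : {t : ℂ | 0 < t.im} ∈ nhds τ :=
      (isOpen_lt continuous_const Complex.continuous_im).mem_nhds hτ
    filter_upwards [this] with t ht using h t ht
  have hd1 : HasDerivAt (fun t : ℂ => -1 / t) (1 / τ ^ 2) τ := by
    have := (hasDerivAt_inv h0).neg
    simp only [neg_neg] at this
    rw [one_div, show (fun t : ℂ => -1 / t) = -fun t : ℂ => t⁻¹ from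
      funext fun t => by rw [Pi.neg_apply, neg_div, one_div]]
    exact this
  have hd2 : HasDerivAt (fun t => f (-1 / t)) (deriv f (-1 / τ) * (1 / τ ^ 2)) τ :=
    (hf _ (im_S hτ)).hasDerivAt.comp τ hd1
  have hd3 : HasDerivAt (fun t => sfac t * g t) (deriv sfac τ * g τ + sfac τ * deriv g τ) τ :=
    (diff_sfac hτ).hasDerivAt.mul (hg τ hτ).hasDerivAt
  have heq := hd2.unique (hd3.congr_of_eventuallyEq hev)
  have heq2 : deriv f (-1 / τ) = τ ^ 2 * (deriv sfac τ * g τ + sfac τ * deriv g τ) := by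
    rw [← heq]; field_simp
  unfold psiLog
  rw [heq2, h τ hτ]
  field_simp

/-! ### The three defects -/

/-- First defect. -/
def f1 (τ : ℂ) : ℂ := theta00 τ ^ 4 - 4 * (psiLog theta10 τ - psiLog theta01 τ)
/-- Second defect. -/
def f2 (τ : ℂ) : ℂ := theta01 τ ^ 4 - 4 * (psiLog theta10 τ - psiLog theta00 τ)
/-- Third defect. -/
def f3 (τ : ℂ) : ℂ := theta10 τ ^ 4 - 4 * (psiLog theta00 τ - psiLog theta01 τ)

lemma psi00_T (τ : ℂ) : psiLog theta00 (τ + 1) = psiLog theta01 τ :=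
  psiLog_T one_ne_zero (fun τ => by rw [theta00_T, one_mul]) τ

lemma psi01_T (τ : ℂ) : psiLog theta01 (τ + 1) = psiLog theta00 τ :=
  psiLog_T one_ne_zero (fun τ => by rw [theta01_T, one_mul]) τ

lemma psi10_T (τ : ℂ) : psiLog theta10 (τ + 1) = psiLog theta10 τ :=
  psiLog_T (Complex.exp_ne_zero _) theta10_T τ

lemma f1_T (τ : ℂ) : f1 (τ + 1) = f2 τ := by
  unfold f1 f2
  rw [theta00_T, psi10_T, psi01_T]

lemma f2_T (τ : ℂ) : f2 (τ + 1) = f1 τ := by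
  unfold f1 f2
  rw [theta01_T, psi10_T, psi00_T]

lemma f3_T (τ : ℂ) : f3 (τ + 1) = -f3 τ := by
  unfold f3
  have e4 : Complex.exp ((Real.pi : ℂ) * Complex.I / 4) ^ 4 = -1 := by
    rw [← Complex.exp_nat_mul, ← Complex.exp_pi_mul_I]
    congr 1; push_cast; ring
  rw [theta10_T, psi00_T, psi01_T, mul_pow, e4]
  ring

lemma f1_S {τ : ℂ} (hτ : 0 < τ.im) : f1 (-1 / τ) = -τ ^ 2 * f1 τ := by
  unfold f1
  rw [theta00_S hτ, psiLog_S (fun _ => theta10_S) (fun _ => diff_theta10) (fun _ => diff_theta01)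
    (fun _ => theta01_ne) hτ, psiLog_S (fun _ => theta01_S) (fun _ => diff_theta01)
    (fun _ => diff_theta10) (fun _ => theta10_ne) hτ, mul_pow, sfac_pow4]
  ring

lemma f2_S {τ : ℂ} (hτ : 0 < τ.im) : f2 (-1 / τ) = -τ ^ 2 * f3 τ := by
  unfold f2 f3
  rw [theta01_S hτ, psiLog_S (fun _ => theta10_S) (fun _ => diff_theta10) (fun _ => diff_theta01)
    (fun _ => theta01_ne) hτ, psiLog_S (fun _ => theta00_S) (fun _ => diff_theta00)
    (fun _ => diff_theta00) (fun _ => theta00_ne) hτ, mul_pow, sfac_pow4]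
  ring

lemma f3_S {τ : ℂ} (hτ : 0 < τ.im) : f3 (-1 / τ) = -τ ^ 2 * f2 τ := by
  unfold f2 f3
  rw [theta10_S hτ, psiLog_S (fun _ => theta01_S) (fun _ => diff_theta01) (fun _ => diff_theta10)
    (fun _ => theta10_ne) hτ, psiLog_S (fun _ => theta00_S) (fun _ => diff_theta00)
    (fun _ => diff_theta00) (fun _ => theta00_ne) hτ, mul_pow, sfac_pow4]
  ring

lemma diff_psiLog {g : ℂ → ℂ} (hd : ∀ τ : ℂ, 0 < τ.im → DifferentiableAt ℂ g τ)
    (h0 : ∀ τ : ℂ, 0 < τ.im → g τ ≠ 0) {τ : ℂ} (hτ : 0 < τ.im) :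
    DifferentiableAt ℂ (psiLog g) τ := by
  have ho : IsOpen {t : ℂ | 0 < t.im} := isOpen_lt continuous_const Complex.continuous_im
  have h1 : DifferentiableOn ℂ g {t : ℂ | 0 < t.im} := fun t ht =>
    (hd t ht).differentiableWithinAt
  have h2 : DifferentiableAt ℂ (deriv g) τ := (h1.deriv ho).differentiableAt (ho.mem_nhds hτ)
  exact (h2.div (hd τ hτ) (h0 τ hτ)).const_mul _

lemma diff_psi00 {τ : ℂ} (hτ : 0 < τ.im) : DifferentiableAt ℂ (psiLog theta00) τ :=
  diff_psiLog (fun _ => diff_theta00) (fun _ => theta00_ne) hτ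

lemma diff_psi01 {τ : ℂ} (hτ : 0 < τ.im) : DifferentiableAt ℂ (psiLog theta01) τ :=
  diff_psiLog (fun _ => diff_theta01) (fun _ => theta01_ne) hτ

lemma diff_psi10 {τ : ℂ} (hτ : 0 < τ.im) : DifferentiableAt ℂ (psiLog theta10) τ :=
  diff_psiLog (fun _ => diff_theta10) (fun _ => theta10_ne) hτ

lemma diff_f1 {τ : ℂ} (hτ : 0 < τ.im) : DifferentiableAt ℂ f1 τ :=
  ((diff_theta00 hτ).pow 4).sub (((diff_psi10 hτ).sub (diff_psi01 hτ)).const_mul 4)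

lemma diff_f2 {τ : ℂ} (hτ : 0 < τ.im) : DifferentiableAt ℂ f2 τ :=
  ((diff_theta01 hτ).pow 4).sub (((diff_psi10 hτ).sub (diff_psi00 hτ)).const_mul 4)

lemma diff_f3 {τ : ℂ} (hτ : 0 < τ.im) : DifferentiableAt ℂ f3 τ :=
  ((diff_theta10 hτ).pow 4).sub (((diff_psi00 hτ).sub (diff_psi01 hτ)).const_mul 4)

lemma psi00_asymp : psiLog theta00 =O[imInf] expE :=
  (logDeriv_asymp one_ne_zero (fun _ => diff_theta00) theta00_asymp).const_mul_left _

lemma psi01_asymp : psiLog theta01 =O[imInf] expE :=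
  (logDeriv_asymp one_ne_zero (fun _ => diff_theta01) theta01_asymp).const_mul_left _

lemma psi10_asymp : (fun τ => psiLog theta10 τ - 1 / 4) =O[imInf] expE := by
  have h : psiLog thetaD =O[imInf] expE :=
    (logDeriv_asymp two_ne_zero (fun _ => diff_thetaD) thetaD_asymp).const_mul_left _
  refine h.congr' ?_ Filter.EventuallyEq.rfl
  filter_upwards [imInf_ge 1, (tendsto_of_asymp thetaD_asymp).eventually_ne two_ne_zero]
    with τ hτ h2
  have hτ0 : 0 < τ.im := by linarith
  have he : HasDerivAt (fun t : ℂ => Complex.exp ((Real.pi : ℂ) * Complex.I * t / 4))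
      (Complex.exp ((Real.pi : ℂ) * Complex.I * τ / 4) * ((Real.pi : ℂ) * Complex.I / 4)) τ := by
    have h1 : HasDerivAt (fun t : ℂ => (Real.pi : ℂ) * Complex.I * t / 4)
        ((Real.pi : ℂ) * Complex.I / 4) τ := by
      simpa using ((hasDerivAt_id τ).const_mul ((Real.pi : ℂ) * Complex.I)).div_const 4
    exact h1.cexp
  have hd := (he.mul (diff_thetaD hτ0).hasDerivAt).deriv
  have hexp := Complex.exp_ne_zero ((Real.pi : ℂ) * Complex.I * τ / 4)
  have hpi : (Real.pi : ℂ) ≠ 0 := by exact_mod_cast Real.pi_ne_zero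
  have hI := Complex.I_ne_zero
  have hd' : deriv theta10 τ = Complex.exp ((Real.pi : ℂ) * Complex.I * τ / 4) *
      ((Real.pi : ℂ) * Complex.I / 4) * thetaD τ +
      Complex.exp ((Real.pi : ℂ) * Complex.I * τ / 4) * deriv thetaD τ := by
    rw [theta10_eq_D]; exact hd
  unfold psiLog
  rw [hd', theta10_eq τ]
  change _ = 1 / (Real.pi * Complex.I) * (_ / (_ * thetaD τ)) - 1 / 4
  generalize Complex.exp ((Real.pi : ℂ) * Complex.I * τ / 4) = e at *
  field_simp
  ring

lemma f1_asymp : f1 =O[imInf] expE :=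
  ((pow4_asymp theta00_asymp).sub ((psi10_asymp.sub psi01_asymp).const_mul_left 4)).congr_left
    fun τ => by unfold f1; ring

lemma f2_asymp : f2 =O[imInf] expE :=
  ((pow4_asymp theta01_asymp).sub ((psi10_asymp.sub psi00_asymp).const_mul_left 4)).congr_left
    fun τ => by unfold f2; ring

lemma f3_asymp : f3 =O[imInf] expE :=
  (theta10_pow4_asymp.sub ((psi00_asymp.sub psi01_asymp).const_mul_left 4)).congr_left
    fun τ => by unfold f3; ring

lemma prod_f_eq_zero {τ : ℂ} (hτ : 0 < τ.im) : f1 τ * f2 τ * f3 τ = 0 := by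
  let F : ℂ → ℂ := fun τ => (f1 τ * f2 τ * f3 τ) ^ 2
  have hFO : F =O[imInf] fun τ => (expE τ * expE τ * expE τ) ^ 2 :=
    ((f1_asymp.mul f2_asymp).mul f3_asymp).pow 2
  have hE6 : Filter.Tendsto (fun τ => (expE τ * expE τ * expE τ) ^ 2) imInf (nhds 0) := by
    simpa using ((tendsto_expE.mul tendsto_expE).mul tendsto_expE).pow 2
  obtain ⟨c, hc⟩ := level_one_twelve F
    (fun τ hτ => (((diff_f1 hτ).mul (diff_f2 hτ)).mul (diff_f3 hτ)).pow 2)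
    (fun τ hτ => by
      simp only [F]; rw [f1_T, f2_T, f3_T]; ring)
    (fun τ hτ => by
      simp only [F]; rw [f1_S hτ, f2_S hτ, f3_S hτ]; ring)
    ((hFO.trans_tendsto hE6).comp tendsto_coe_imInf)
  have ho : (fun τ => (expE τ * expE τ * expE τ) ^ 2) =o[imInf] fun τ => expE τ ^ 2 := by
    have h1 : (fun τ => expE τ ^ 4) =o[imInf] (fun _ => (1 : ℝ)) := by
      rw [Asymptotics.isLittleO_one_iff]
      simpa using tendsto_expE.pow 4
    have := h1.mul_isBigO (Asymptotics.isBigO_refl (fun τ => expE τ ^ 2) imInf)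
    simp only [one_mul] at this
    exact this.congr_left fun τ => by ring
  have h1 : (fun τ : UpperHalfPlane => F τ) =o[UpperHalfPlane.atImInfty]
      ModularForm.discriminant := by
    have h2 := (hFO.trans_isLittleO ho).comp_tendsto tendsto_coe_imInf
    refine h2.trans_isBigO ?_
    refine ModularForm.exp_isBigO_discriminant.congr_left fun τ => ?_
    simp only [Function.comp, expE, ← Real.exp_nat_mul]
    congr 1
    push_cast
    rw [UpperHalfPlane.coe_im]
    ring
  have hc0 : c = 0 := by
    by_contra hne
    have h2 : (fun τ : UpperHalfPlane => c * ModularForm.discriminant τ)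
        =o[UpperHalfPlane.atImInfty] ModularForm.discriminant :=
      h1.congr_left hc
    have h3 := (Asymptotics.isLittleO_const_mul_left_iff hne).mp h2
    have h4 := Asymptotics.isLittleO_irrefl (l := UpperHalfPlane.atImInfty)
      (f'' := ModularForm.discriminant)
      (Filter.Frequently.of_forall fun τ => ModularForm.discriminant_ne_zero τ)
    exact h4 h3
  have h := hc ⟨τ, hτ⟩
  rw [hc0, zero_mul] at h
  exact pow_eq_zero_iff two_ne_zero |>.mp h

lemma mul_eq_zero_cases {f g : ℂ → ℂ} (hf : ∀ τ : ℂ, 0 < τ.im → DifferentiableAt ℂ f τ)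
    (hg : ∀ τ : ℂ, 0 < τ.im → DifferentiableAt ℂ g τ)
    (h : ∀ τ : ℂ, 0 < τ.im → f τ * g τ = 0) :
    (∀ τ : ℂ, 0 < τ.im → f τ = 0) ∨ (∀ τ : ℂ, 0 < τ.im → g τ = 0) := by
  by_contra hcon
  push Not at hcon
  obtain ⟨⟨t, ht, hft⟩, ⟨u, hu, hgu⟩⟩ := hcon
  have ho : IsOpen {t : ℂ | 0 < t.im} := isOpen_lt continuous_const Complex.continuous_im
  have hga : AnalyticOnNhd ℂ g {t : ℂ | 0 < t.im} :=
    DifferentiableOn.analyticOnNhd (fun t ht => (hg t ht).differentiableWithinAt) ho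
  have hpc : IsPreconnected {t : ℂ | 0 < t.im} := (convex_halfSpace_im_gt 0).isPreconnected
  have hev : g =ᶠ[nhds t] 0 := by
    filter_upwards [(hf t ht).continuousAt.eventually_ne hft, ho.mem_nhds ht] with z hz hz2
    exact (mul_eq_zero.mp (h z hz2)).resolve_left hz
  exact hgu (hga.eqOn_zero_of_preconnected_of_eventuallyEq_zero hpc ht hev hu)

lemma im_add_one {τ : ℂ} (hτ : 0 < τ.im) : 0 < (τ + 1).im := by simpa using hτ

lemma f3_of_f2 (h : ∀ τ : ℂ, 0 < τ.im → f2 τ = 0) {τ : ℂ} (hτ : 0 < τ.im) : f3 τ = 0 := by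
  have := f2_S hτ
  rw [h _ (im_S hτ)] at this
  simpa [ne_zero_of_im hτ] using this.symm

lemma f2_of_f3 (h : ∀ τ : ℂ, 0 < τ.im → f3 τ = 0) {τ : ℂ} (hτ : 0 < τ.im) : f2 τ = 0 := by
  have := f3_S hτ
  rw [h _ (im_S hτ)] at this
  simpa [ne_zero_of_im hτ] using this.symm

lemma f2_zero : ∀ τ : ℂ, 0 < τ.im → f2 τ = 0 := by
  rcases mul_eq_zero_cases (fun τ hτ => (diff_f1 hτ).mul (diff_f2 hτ)) (fun _ => diff_f3)
    (fun τ hτ => prod_f_eq_zero hτ) with h | h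
  · rcases mul_eq_zero_cases (fun _ => diff_f1) (fun _ => diff_f2) h with h | h
    · intro τ hτ
      rw [← f1_T]
      exact h _ (im_add_one hτ)
    · exact h
  · exact fun τ hτ => f2_of_f3 h hτ

/-- `θ₀₀⁴ = 4(ψ₁₀ − ψ₀₁)`, `θ₀₁⁴ = 4(ψ₁₀ − ψ₀₀)`,
`θ₁₀⁴ = 4(ψ₀₀ − ψ₀₁)` on the upper half plane. -/
theorem thetanull_fourth_powers_genus_one (τ : ℂ) (hτ : 0 < τ.im) :
    theta00 τ ^ 4 = 4 * (psiLog theta10 τ - psiLog theta01 τ) ∧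
    theta01 τ ^ 4 = 4 * (psiLog theta10 τ - psiLog theta00 τ) ∧
    theta10 τ ^ 4 = 4 * (psiLog theta00 τ - psiLog theta01 τ) := by
  have h2 := f2_zero τ hτ
  have h3 := f3_of_f2 f2_zero hτ
  have h1 : f1 τ = 0 := by
    rw [← f2_T]
    exact f2_zero _ (im_add_one hτ)
  exact ⟨sub_eq_zero.mp h1, sub_eq_zero.mp h2, sub_eq_zero.mp h3⟩
end
end

section
/- Let λ = (θ_{10}/θ_{00})⁴ be Legendre's modular function on the upper half plane ℍ. Then for every τ ∈ ℍ: (1/πi)·λ′(τ) = λ(τ)·θ_{01}(τ)⁴ = λ(τ)(1−λ(τ))·θ_{00}(τ)⁴. -/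
open Complex BigOperators

noncomputable section

open Filter Topology

/-- General theta-type series. -/
def Th (c : ℤ → ℂ) (a : ℝ) (τ : ℂ) : ℂ :=
  ∑' n : ℤ, c n * Complex.exp ((Real.pi : ℂ) * Complex.I * ((n : ℂ) + (a : ℂ)) ^ 2 * τ)

def sg (n : ℤ) : ℂ := (-1 : ℂ) ^ n

lemma sg_add (m n : ℤ) : sg (m + n) = sg m * sg n := by
  unfold sg; exact zpow_add₀ (by norm_num) m n

lemma sg_sq (m : ℤ) : sg m * sg m = 1 := by
  unfold sg; rw [← mul_zpow]; norm_num

lemma sg_neg (m : ℤ) : sg (-m) = sg m := by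
  unfold sg; rw [zpow_neg, ← inv_zpow]; norm_num

lemma sg_one : sg 1 = -1 := by simp [sg]

lemma sg_sub (m n : ℤ) : sg (m - n) = sg m * sg n := by
  rw [sub_eq_add_neg, sg_add, sg_neg]

lemma norm_sg (m : ℤ) : ‖sg m‖ = 1 := by
  simp [sg]

lemma norm_term (x : ℝ) (τ : ℂ) :
    ‖Complex.exp ((Real.pi : ℂ) * Complex.I * (x : ℂ) ^ 2 * τ)‖ =
      Real.exp (-Real.pi * x ^ 2 * τ.im) := by
  rw [Complex.norm_exp]
  congr 1
  have : (Real.pi : ℂ) * Complex.I * (x : ℂ) ^ 2 * τ =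
      ((Real.pi * x ^ 2 : ℝ) : ℂ) * (Complex.I * τ) := by push_cast; ring
  rw [this, Complex.re_ofReal_mul]
  simp

lemma norm_term' (n : ℤ) (a : ℝ) (τ : ℂ) :
    ‖Complex.exp ((Real.pi : ℂ) * Complex.I * ((n : ℂ) + (a : ℂ)) ^ 2 * τ)‖ =
      Real.exp (-Real.pi * (n + a) ^ 2 * τ.im) := by
  rw [← norm_term]; push_cast; rfl

lemma summable_bound (a : ℝ) {Y : ℝ} (hY : 0 < Y) :
    Summable (fun n : ℤ => ((|(n : ℝ)| + 1) ^ 2) * Real.exp (-Real.pi * (n + a) ^ 2 * Y)) := by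
  have h0 := summable_pow_mul_jacobiTheta₂_term_bound (|a| * Y) hY 0
  have h1 := summable_pow_mul_jacobiTheta₂_term_bound (|a| * Y) hY 1
  have h2 := summable_pow_mul_jacobiTheta₂_term_bound (|a| * Y) hY 2
  refine Summable.of_nonneg_of_le (fun n => by positivity) (fun n => ?_)
    ((h2.add (h1.mul_left 2)).add h0)
  have : Real.exp (-Real.pi * (n + a) ^ 2 * Y) ≤
      Real.exp (-Real.pi * (Y * n ^ 2 - 2 * (|a| * Y) * |(n : ℝ)|)) := by
    apply Real.exp_le_exp.mpr
    have h3 : -(|a| * |(n : ℝ)|) ≤ a * n := by rw [← abs_mul]; exact neg_abs_le _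
    have h4 : Y * n ^ 2 - 2 * (|a| * Y) * |(n : ℝ)| ≤ (n + a) ^ 2 * Y := by
      nlinarith [mul_le_mul_of_nonneg_left h3 hY.le, mul_nonneg hY.le (sq_nonneg a)]
    nlinarith [mul_le_mul_of_nonneg_left h4 Real.pi_pos.le]
  calc _ ≤ ((|(n : ℝ)| + 1) ^ 2) *
        Real.exp (-Real.pi * (Y * n ^ 2 - 2 * (|a| * Y) * |(n : ℝ)|)) := by gcongr
    _ = _ := by push_cast; ring

/-- Polynomial growth condition for the coefficients. -/
def PB (c : ℤ → ℂ) : Prop := ∀ n : ℤ, ‖c n‖ ≤ (|(n : ℝ)| + 1) ^ 2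

lemma PB_one : PB (fun _ => 1) := by
  intro n; simp only [norm_one]; nlinarith [abs_nonneg (n : ℝ)]

lemma PB_sg : PB sg := by
  intro n; rw [norm_sg]; nlinarith [abs_nonneg (n : ℝ)]

lemma PB_half (n : ℤ) : ‖(n : ℂ) + 1 / 2‖ ≤ |(n : ℝ)| + 1 := by
  refine (norm_add_le _ _).trans ?_
  rw [Complex.norm_intCast]; norm_num

lemma PB_S : PB (fun n => sg n * ((n : ℂ) + 1 / 2)) := by
  intro n
  simp only [norm_mul, norm_sg, one_mul]
  refine (PB_half n).trans ?_
  nlinarith [abs_nonneg (n : ℝ)]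

lemma PB_D0 : PB (fun n => (n : ℂ) ^ 2) := by
  intro n
  simp only [norm_pow, Complex.norm_intCast]
  gcongr; linarith

lemma PB_D1 : PB (fun n => ((n : ℂ) + 1 / 2) ^ 2) := by
  intro n
  simp only [norm_pow]
  gcongr; exact PB_half n

lemma PB_sgn : PB (fun n => sg n * (n : ℂ)) := by
  intro n
  simp only [norm_mul, norm_sg, one_mul, Complex.norm_intCast]
  nlinarith [abs_nonneg (n : ℝ)]

lemma norm_le_bound {c : ℤ → ℂ} (hc : PB c) (a : ℝ) {Y : ℝ} {τ : ℂ} (hτ : Y ≤ τ.im) (n : ℤ) :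
    ‖c n * Complex.exp ((Real.pi : ℂ) * Complex.I * ((n : ℂ) + (a : ℂ)) ^ 2 * τ)‖ ≤
      ((|(n : ℝ)| + 1) ^ 2) * Real.exp (-Real.pi * (n + a) ^ 2 * Y) := by
  rw [norm_mul, norm_term']
  gcongr ?_ * Real.exp ?_
  · exact hc n
  · have : 0 ≤ Real.pi * (n + a) ^ 2 := by positivity
    nlinarith [mul_le_mul_of_nonneg_left hτ this]

lemma summable_Th {c : ℤ → ℂ} (hc : PB c) (a : ℝ) {τ : ℂ} (hτ : 0 < τ.im) :
    Summable (fun n : ℤ =>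
      ‖c n * Complex.exp ((Real.pi : ℂ) * Complex.I * ((n : ℂ) + (a : ℂ)) ^ 2 * τ)‖) :=
  Summable.of_nonneg_of_le (fun _ => norm_nonneg _) (norm_le_bound hc a le_rfl)
    (summable_bound a hτ)

lemma hasDerivAt_Th {c : ℤ → ℂ} (hc : PB c) (a : ℝ) {τ : ℂ} (hτ : 0 < τ.im) :
    HasDerivAt (Th c a)
      ((Real.pi : ℂ) * Complex.I * Th (fun n => c n * ((n : ℂ) + (a : ℂ)) ^ 2) a τ) τ := by
  set U : Set ℂ := {z | τ.im / 2 < z.im} with hU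
  have hUo : IsOpen U := isOpen_lt continuous_const Complex.continuous_im
  have hmem : τ ∈ U := by simp only [hU, Set.mem_ofPred_eq]; linarith
  have hd : ∀ n : ℤ, ∀ z : ℂ, HasDerivAt (fun z : ℂ =>
      c n * Complex.exp ((Real.pi : ℂ) * Complex.I * ((n : ℂ) + (a : ℂ)) ^ 2 * z))
      ((Real.pi : ℂ) * Complex.I * (c n * ((n : ℂ) + (a : ℂ)) ^ 2 *
        Complex.exp ((Real.pi : ℂ) * Complex.I * ((n : ℂ) + (a : ℂ)) ^ 2 * z))) z := by
    intro n z
    have := (((hasDerivAt_id z).const_mul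
      ((Real.pi : ℂ) * Complex.I * ((n : ℂ) + (a : ℂ)) ^ 2)).cexp).const_mul (c n)
    refine this.congr_deriv ?_
    simp only [id]
    ring
  have hs := summable_bound a (half_pos hτ)
  have hb : ∀ (n : ℤ) (w : ℂ), w ∈ U → _ := fun n w hw => norm_le_bound hc a (le_of_lt hw) n
  have h1 := Complex.hasSum_deriv_of_summable_norm hs
    (fun n z _ => (hd n z).differentiableAt.differentiableWithinAt) hUo hb hmem
  have h2 := Complex.differentiableOn_tsum_of_summable_norm hs
    (fun n z _ => (hd n z).differentiableAt.differentiableWithinAt) hUo hb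
  have h3 := (h2.differentiableAt (hUo.mem_nhds hmem)).hasDerivAt
  rw [← h1.tsum_eq] at h3
  unfold Th
  rw [← tsum_mul_left]
  simp_rw [(hd _ τ).deriv] at h3
  exact h3

lemma tsum_split (f : ℤ × ℤ → ℂ) (hf : Summable f) :
    ∑' p, f p = ∑' p : ℤ × ℤ, f (p.1 + p.2, p.1 - p.2) +
      ∑' p : ℤ × ℤ, f (p.1 + p.2, p.1 - p.2 - 1) := by
  let e : ℤ × ℤ → ℤ × ℤ := fun p => (p.1 + p.2, p.1 - p.2)
  let o : ℤ × ℤ → ℤ × ℤ := fun p => (p.1 + p.2, p.1 - p.2 - 1)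
  have he : Function.Injective e := by
    rintro ⟨a, b⟩ ⟨c, d⟩ h
    simp only [e, Prod.mk.injEq] at h ⊢
    omega
  have ho : Function.Injective o := by
    rintro ⟨a, b⟩ ⟨c, d⟩ h
    simp only [o, Prod.mk.injEq] at h ⊢
    omega
  have hc : IsCompl (Set.range e) (Set.range o) := by
    constructor
    · rw [Set.disjoint_left]
      rintro _ ⟨⟨a, b⟩, rfl⟩ ⟨⟨c, d⟩, h⟩
      simp only [e, o, Prod.mk.injEq] at h
      omega
    · rw [codisjoint_iff_le_sup]
      rintro ⟨m, n⟩ -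
      rcases Int.even_or_odd' (m + n) with ⟨k, hk | hk⟩
      · left; refine ⟨(k, m - k), ?_⟩
        simp only [e, Prod.mk.injEq]; omega
      · right; refine ⟨(k + 1, m - k - 1), ?_⟩
        simp only [o, Prod.mk.injEq]; omega
  have h1 := (he.hasSum_range_iff (f := f) (a := ∑' p, f (e p))).2
    (hf.comp_injective he).hasSum
  have h2 := (ho.hasSum_range_iff (f := f) (a := ∑' p, f (o p))).2
    (hf.comp_injective ho).hasSum
  exact (h1.add_isCompl hc h2).tsum_eq

lemma prod_split (f g : ℤ → ℂ) (hf : Summable fun n => ‖f n‖) (hg : Summable fun n => ‖g n‖) :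
    (∑' n, f n) * (∑' n, g n) = ∑' p : ℤ × ℤ, f (p.1 + p.2) * g (p.1 - p.2) +
      ∑' p : ℤ × ℤ, f (p.1 + p.2) * g (p.1 - p.2 - 1) := by
  rw [tsum_mul_tsum_of_summable_norm hf hg]
  exact tsum_split (fun z => f z.1 * g z.2) (summable_mul_of_summable_norm hf hg)

lemma Th_mul {c d : ℤ → ℂ} (hc : PB c) (hd : PB d) (a b : ℝ) {τ : ℂ} (hτ : 0 < τ.im) :
    Th c a τ * Th d b τ = ∑' p : ℤ × ℤ, c p.1 * d p.2 *
      Complex.exp ((Real.pi : ℂ) * Complex.I *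
        (((p.1 : ℂ) + (a : ℂ)) ^ 2 + ((p.2 : ℂ) + (b : ℂ)) ^ 2) * τ) := by
  unfold Th
  rw [tsum_mul_tsum_of_summable_norm (summable_Th hc a hτ) (summable_Th hd b hτ)]
  refine tsum_congr fun p => ?_
  rw [mul_mul_mul_comm, ← Complex.exp_add]
  congr 2; ring

lemma summable_Th_mul {c d : ℤ → ℂ} (hc : PB c) (hd : PB d) (a b : ℝ) {τ : ℂ} (hτ : 0 < τ.im) :
    Summable fun p : ℤ × ℤ => c p.1 * d p.2 *
      Complex.exp ((Real.pi : ℂ) * Complex.I *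
        (((p.1 : ℂ) + (a : ℂ)) ^ 2 + ((p.2 : ℂ) + (b : ℂ)) ^ 2) * τ) := by
  refine (summable_mul_of_summable_norm (summable_Th hc a hτ) (summable_Th hd b hτ)).congr
    fun p => ?_
  rw [mul_mul_mul_comm, ← Complex.exp_add]
  congr 2; ring

lemma Th_split {c d : ℤ → ℂ} (hc : PB c) (hd : PB d) (a b : ℝ) {τ : ℂ} (hτ : 0 < τ.im) :
    Th c a τ * Th d b τ = ∑' p : ℤ × ℤ, c (p.1 + p.2) * d (p.1 - p.2) *
      Complex.exp ((Real.pi : ℂ) * Complex.I *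
        (((p.1 : ℂ) + p.2 + (a : ℂ)) ^ 2 + ((p.1 : ℂ) - p.2 + (b : ℂ)) ^ 2) * τ) +
      ∑' p : ℤ × ℤ, c (p.1 + p.2) * d (p.1 - p.2 - 1) *
      Complex.exp ((Real.pi : ℂ) * Complex.I *
        (((p.1 : ℂ) + p.2 + (a : ℂ)) ^ 2 + ((p.1 : ℂ) - p.2 - 1 + (b : ℂ)) ^ 2) * τ) := by
  rw [Th_mul hc hd a b hτ]
  have := tsum_split _ (summable_Th_mul hc hd a b hτ)
  push_cast at this
  exact this

lemma Th_zero (τ : ℂ) : Th sg (1 / 2) τ = 0 := by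
  have h : Th sg (1 / 2) τ = - Th sg (1 / 2) τ := by
    conv_lhs => unfold Th
    rw [← (Equiv.subLeft (-1 : ℤ)).tsum_eq]
    unfold Th
    rw [← tsum_neg]
    refine tsum_congr fun n => ?_
    rw [Equiv.subLeft_apply, sg_sub, sg_neg, sg_one]
    have : ((((-1 - n : ℤ) : ℂ)) + ((1 / 2 : ℝ) : ℂ)) ^ 2 = ((n : ℂ) + ((1 / 2 : ℝ) : ℂ)) ^ 2 := by
      push_cast; ring
    rw [this]; ring
  exact self_eq_neg.mp h

lemma theta00_eq_s11 (τ : ℂ) : theta00 τ = Th (fun _ => 1) 0 τ := by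
  simp [theta00, Th]

lemma theta01_eq_s11 (τ : ℂ) : theta01 τ = Th sg 0 τ := by
  simp [theta01, Th, sg]

lemma theta10_eq_s11 (τ : ℂ) : theta10 τ = Th (fun _ => 1) (1 / 2) τ := by
  simp [theta10, Th]

def SS (τ : ℂ) : ℂ := Th (fun n => sg n * ((n : ℂ) + 1 / 2)) (1 / 2) τ

/-- Shift `a` by one. -/
lemma Th_neg_half (c : ℤ → ℂ) (τ : ℂ) :
    Th (fun n => c (n - 1)) (-1 / 2) τ = Th c (1 / 2) τ := by
  unfold Th
  rw [← (Equiv.addRight (1 : ℤ)).tsum_eq]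
  refine tsum_congr fun n => ?_
  simp only [Equiv.coe_addRight, add_sub_cancel_right]
  congr 3; push_cast; ring

lemma two_im {τ : ℂ} (hτ : 0 < τ.im) : 0 < (2 * τ).im := by
  simpa using hτ

lemma dup00 {τ : ℂ} (hτ : 0 < τ.im) :
    theta00 τ ^ 2 = theta00 (2 * τ) ^ 2 + theta10 (2 * τ) ^ 2 := by
  simp only [theta00_eq_s11, theta10_eq_s11, sq]
  rw [Th_split PB_one PB_one 0 0 hτ, Th_mul PB_one PB_one 0 0 (two_im hτ)]
  nth_rewrite 1 [← Th_neg_half]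
  rw [Th_mul PB_one PB_one (-1 / 2) (1 / 2) (two_im hτ)]
  congr 1 <;> refine tsum_congr fun p => ?_ <;> congr 2 <;> push_cast <;> ring

lemma dup01 {τ : ℂ} (hτ : 0 < τ.im) :
    theta01 τ ^ 2 = theta00 (2 * τ) ^ 2 - theta10 (2 * τ) ^ 2 := by
  simp only [theta00_eq_s11, theta10_eq_s11, theta01_eq_s11, sq]
  rw [Th_split PB_sg PB_sg 0 0 hτ, Th_mul PB_one PB_one 0 0 (two_im hτ)]
  nth_rewrite 1 [← Th_neg_half]
  rw [Th_mul PB_one PB_one (-1 / 2) (1 / 2) (two_im hτ), sub_eq_add_neg, ← tsum_neg]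
  congr 1 <;> refine tsum_congr fun p => ?_
  · congr 1
    · rw [sg_add, sg_sub]; linear_combination (sg p.2 * sg p.2) * sg_sq p.1 + sg_sq p.2
    · congr 1; push_cast; ring
  · rw [← neg_mul]
    congr 1
    · rw [sg_add, sg_sub, sg_sub, sg_one]
      linear_combination -(sg p.2 * sg p.2) * sg_sq p.1 - sg_sq p.2
    · congr 1; push_cast; ring

lemma dup10 {τ : ℂ} (hτ : 0 < τ.im) :
    theta10 τ ^ 2 = 2 * theta00 (2 * τ) * theta10 (2 * τ) := by
  have e : 2 * theta00 (2 * τ) * theta10 (2 * τ) =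
    theta10 (2 * τ) * theta00 (2 * τ) + theta00 (2 * τ) * theta10 (2 * τ) := by ring
  rw [e]
  simp only [theta00_eq_s11, theta10_eq_s11, sq]
  rw [Th_split PB_one PB_one _ _ hτ, Th_mul PB_one PB_one (1 / 2) 0 (two_im hτ),
    Th_mul PB_one PB_one 0 (1 / 2) (two_im hτ)]
  congr 1 <;> refine tsum_congr fun p => ?_ <;> congr 2 <;> push_cast <;> ring

lemma dup0001 {τ : ℂ} (hτ : 0 < τ.im) :
    theta00 τ * theta01 τ = theta01 (2 * τ) ^ 2 := by
  have e : theta01 (2 * τ) ^ 2 = Th sg 0 (2 * τ) * Th sg 0 (2 * τ) +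
      Th (fun n => (fun m => sg m * sg 0) (n - 1)) (-1/2) (2 * τ) * Th sg (1 / 2) (2 * τ) := by
    rw [Th_zero, theta01_eq_s11]; ring
  have hPB : PB (fun n => (fun m => sg m * sg 0) (n - 1)) := by
    intro n; simp only [norm_mul, norm_sg]; nlinarith [abs_nonneg (n : ℝ)]
  rw [e]
  simp only [theta00_eq_s11, theta01_eq_s11]
  rw [Th_split PB_one PB_sg _ _ hτ, Th_mul PB_sg PB_sg 0 0 (two_im hτ),
    Th_mul hPB PB_sg (-1/2) (1 / 2) (two_im hτ)]
  congr 1 <;> refine tsum_congr fun p => ?_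
  · congr 1
    · rw [sg_sub]; ring
    · congr 1; push_cast; ring
  · congr 1
    · simp only [sg_sub, sg_one]; simp [sg]
    · congr 1; push_cast; ring

lemma dupS {τ : ℂ} (hτ : 0 < τ.im) :
    SS τ * theta10 τ = 2 * theta01 (2 * τ) * SS (2 * τ) := by
  have e : 2 * theta01 (2 * τ) * SS (2 * τ) =
      (SS (2 * τ) * Th sg 0 (2 * τ) + Th sg (1 / 2) (2 * τ) * Th (fun n => sg n * n) 0 (2 * τ)) +
      (Th sg 0 (2 * τ) * SS (2 * τ) +
        Th (fun n => sg n * n) 0 (2 * τ) * Th sg (1 / 2) (2 * τ)) := by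
    rw [Th_zero, theta01_eq_s11]; ring
  rw [e]
  simp only [theta10_eq_s11, SS]
  have h2 := two_im hτ
  rw [Th_split PB_S PB_one _ _ hτ, Th_mul PB_S PB_sg _ _ h2, Th_mul PB_sg PB_sgn _ _ h2,
    Th_mul PB_sg PB_S _ _ h2, Th_mul PB_sgn PB_sg _ _ h2,
    ← (summable_Th_mul PB_S PB_sg _ _ h2).tsum_add (summable_Th_mul PB_sg PB_sgn _ _ h2),
    ← (summable_Th_mul PB_sg PB_S _ _ h2).tsum_add (summable_Th_mul PB_sgn PB_sg _ _ h2)]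
  congr 1 <;> refine tsum_congr fun p => ?_ <;> rw [← add_mul] <;> congr 1
  · rw [sg_add]; push_cast; ring
  · congr 1; push_cast; ring
  · rw [sg_add]; push_cast; ring
  · congr 1; push_cast; ring

/-- `D θ₀₀` and `D θ₁₀` with `D = (1/πi) d/dτ`. -/
def D00 (τ : ℂ) : ℂ := Th (fun n => (n : ℂ) ^ 2) 0 τ
def D10 (τ : ℂ) : ℂ := Th (fun n => ((n : ℂ) + 1 / 2) ^ 2) (1 / 2) τ

lemma wronskian {τ : ℂ} (hτ : 0 < τ.im) :
    SS τ ^ 2 = 2 * (D10 (2 * τ) * theta00 (2 * τ) - theta10 (2 * τ) * D00 (2 * τ)) := by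
  have e : 2 * (D10 (2 * τ) * theta00 (2 * τ) - theta10 (2 * τ) * D00 (2 * τ)) =
      (D10 (2 * τ) * theta00 (2 * τ) - theta10 (2 * τ) * D00 (2 * τ)) +
      (theta00 (2 * τ) * D10 (2 * τ) - D00 (2 * τ) * theta10 (2 * τ)) := by ring
  rw [e]
  have h2 := two_im hτ
  simp only [theta10_eq_s11, theta00_eq_s11, D00, D10, SS, sq (Th _ _ _)]
  rw [Th_split PB_S PB_S _ _ hτ, Th_mul PB_D1 PB_one _ _ h2, Th_mul PB_one PB_D0 _ _ h2,
    Th_mul PB_one PB_D1 _ _ h2, Th_mul PB_D0 PB_one _ _ h2,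
    ← (summable_Th_mul PB_D1 PB_one _ _ h2).tsum_sub (summable_Th_mul PB_one PB_D0 _ _ h2),
    ← (summable_Th_mul PB_one PB_D1 _ _ h2).tsum_sub (summable_Th_mul PB_D0 PB_one _ _ h2)]
  have hs : ∀ p : ℤ × ℤ, sg p.1 * sg p.2 * (sg p.1 * sg p.2) = 1 := fun p => by
    linear_combination (sg p.2 * sg p.2) * sg_sq p.1 + sg_sq p.2
  congr 1 <;> refine tsum_congr fun p => ?_ <;> rw [← sub_mul] <;> congr 1
  · rw [sg_add, sg_sub]; push_cast
    linear_combination ((p.1 + p.2 + 1 / 2 : ℂ) * (p.1 - p.2 + 1 / 2)) * hs p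
  · congr 1; push_cast; ring
  · rw [sg_add, sg_sub, sg_sub, sg_one]; push_cast
    linear_combination (-(p.1 + p.2 + 1 / 2 : ℂ) * (p.1 - p.2 - 1 + 1 / 2)) * hs p
  · congr 1; push_cast; ring

lemma jacobi_id {τ : ℂ} (hτ : 0 < τ.im) : theta00 τ ^ 4 = theta01 τ ^ 4 + theta10 τ ^ 4 := by
  have h0 := dup00 hτ
  have h1 := dup01 hτ
  have h2 := dup10 hτ
  have e : ∀ x : ℂ, x ^ 4 = (x ^ 2) ^ 2 := fun x => by ring
  rw [e, e (theta01 τ), e (theta10 τ), h0, h1, h2]; ring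

/-- Behaviour at `i∞`. -/
lemma Th_tendsto {c : ℤ → ℂ} (hc : PB c) (a : ℝ) (ha : ∀ n : ℤ, 0 ≤ (n : ℝ) ^ 2 + 2 * a * n) :
    Tendsto (fun τ => Complex.exp (-((Real.pi : ℂ) * Complex.I * (a : ℂ) ^ 2 * τ)) * Th c a τ)
      (comap Complex.im atTop)
      (𝓝 (∑' n : ℤ, if (n : ℝ) ^ 2 + 2 * a * n = 0 then c n else 0)) := by
  have key : ∀ (τ : ℂ) (n : ℤ), ‖Complex.exp (-((Real.pi : ℂ) * Complex.I * (a : ℂ) ^ 2 * τ)) *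
      (c n * Complex.exp ((Real.pi : ℂ) * Complex.I * ((n : ℂ) + (a : ℂ)) ^ 2 * τ))‖ =
      ‖c n‖ * Real.exp (-(Real.pi * ((n : ℝ) ^ 2 + 2 * a * n) * τ.im)) := by
    intro τ n
    rw [norm_mul, norm_mul, Complex.exp_neg, norm_inv, norm_term, norm_term', ← Real.exp_neg,
      mul_left_comm, ← Real.exp_add]
    congr 2; ring
  have hlim : Tendsto Complex.im (comap Complex.im atTop) atTop := tendsto_comap
  unfold Th
  simp_rw [← tsum_mul_left]
  refine tendsto_tsum_of_dominated_convergence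
    (bound := fun n : ℤ => Real.exp (Real.pi * a ^ 2) *
      (((|(n : ℝ)| + 1) ^ 2) * Real.exp (-Real.pi * (n + a) ^ 2 * 1)))
    ((summable_bound a one_pos).mul_left _) ?_ ?_
  · intro n
    split_ifs with h
    · refine tendsto_const_nhds.congr fun τ => ?_
      rw [mul_left_comm, ← Complex.exp_add]
      have : -((Real.pi : ℂ) * Complex.I * (a : ℂ) ^ 2 * τ) +
          (Real.pi : ℂ) * Complex.I * ((n : ℂ) + (a : ℂ)) ^ 2 * τ = 0 := by
        have h' : (n : ℂ) ^ 2 + 2 * a * n = 0 := by exact_mod_cast h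
        linear_combination (Real.pi : ℂ) * Complex.I * τ * h'
      rw [this]; simp
    · rw [tendsto_zero_iff_norm_tendsto_zero]
      simp_rw [key]
      have hpos : 0 < Real.pi * ((n : ℝ) ^ 2 + 2 * a * n) :=
        mul_pos Real.pi_pos (lt_of_le_of_ne (ha n) (Ne.symm h))
      have := (Real.tendsto_exp_neg_atTop_nhds_zero.comp
        (hlim.const_mul_atTop hpos)).const_mul ‖c n‖
      simpa using this
  · filter_upwards [hlim.eventually (eventually_ge_atTop 1)] with τ hτ n
    rw [key, mul_left_comm, ← Real.exp_add]
    gcongr ?_ * Real.exp ?_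
    · exact hc n
    · have : 0 ≤ Real.pi * ((n : ℝ) ^ 2 + 2 * a * n) := mul_nonneg Real.pi_pos.le (ha n)
      nlinarith [mul_le_mul_of_nonneg_left hτ this]

lemma Th_tendsto0 {c : ℤ → ℂ} (hc : PB c) :
    Tendsto (Th c 0) (comap Complex.im atTop) (𝓝 (c 0)) := by
  have h := Th_tendsto hc 0 (fun n => by simpa using sq_nonneg (n : ℝ))
  have e : (∑' n : ℤ, if (n : ℝ) ^ 2 + 2 * 0 * n = 0 then c n else 0) = c 0 := by
    rw [tsum_eq_single 0]
    · simp
    · intro n hn; simp [hn]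
  rw [e] at h
  simpa using h

lemma Th_tendsto1 {c : ℤ → ℂ} (hc : PB c) :
    Tendsto (fun τ => Complex.exp (-((Real.pi : ℂ) * Complex.I * ((1 / 2 : ℝ) : ℂ) ^ 2 * τ)) *
      Th c (1 / 2) τ) (comap Complex.im atTop) (𝓝 (c 0 + c (-1))) := by
  have e1 : ∀ n : ℤ, (n : ℝ) ^ 2 + 2 * (1 / 2) * n = ((n * (n + 1) : ℤ) : ℝ) := by
    intro n; push_cast; ring
  have h := Th_tendsto hc (1 / 2) (fun n => by
    rw [e1]
    have : 0 ≤ n * (n + 1) := by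
      rcases le_or_gt 0 n with h | h
      · positivity
      · nlinarith
    exact_mod_cast this)
  have e : (∑' n : ℤ, if (n : ℝ) ^ 2 + 2 * (1 / 2) * n = 0 then c n else 0) = c 0 + c (-1) := by
    rw [tsum_eq_sum (s := {0, -1})]
    · rw [Finset.sum_pair (by norm_num)]
      norm_num
    · intro n hn
      rw [if_neg]
      rw [e1]
      simp only [Finset.mem_insert, Finset.mem_singleton, not_or] at hn
      have : n * (n + 1) ≠ 0 := mul_ne_zero hn.1 (by omega)
      exact_mod_cast this
  rw [e] at h
  exact h

def PP (τ : ℂ) : ℂ := theta00 τ * theta01 τ * theta10 τ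

lemma dupP {τ : ℂ} (hτ : 0 < τ.im) :
    PP τ * theta10 τ = 2 * theta01 (2 * τ) * PP (2 * τ) := by
  have h1 := dup0001 hτ
  have h2 := dup10 hτ
  unfold PP
  linear_combination (theta10 τ) ^ 2 * h1 + theta01 (2 * τ) ^ 2 * h2

lemma PP_ne_of_two {τ : ℂ} (hτ : 0 < τ.im) (h : PP (2 * τ) ≠ 0) : PP τ ≠ 0 := by
  intro h0
  have := dupP hτ
  rw [h0, zero_mul] at this
  have h1 : theta01 (2 * τ) ≠ 0 := fun h1 => h (by simp [PP, h1])
  exact mul_ne_zero (mul_ne_zero two_ne_zero h1) h this.symm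

lemma lim_P : Tendsto (fun τ => Complex.exp (-((Real.pi : ℂ) * Complex.I * ((1 / 2 : ℝ) : ℂ) ^ 2
    * τ)) * PP τ) (comap Complex.im atTop) (𝓝 2) := by
  have h := ((Th_tendsto0 PB_one).mul (Th_tendsto0 PB_sg)).mul (Th_tendsto1 PB_one)
  have e : (1 : ℂ) * sg 0 * (1 + 1) = 2 := by norm_num [sg]
  rw [e] at h
  refine h.congr fun τ => ?_
  simp only [PP, theta00_eq_s11, theta01_eq_s11, theta10_eq_s11]; ring

lemma lim_S : Tendsto (fun τ => Complex.exp (-((Real.pi : ℂ) * Complex.I * ((1 / 2 : ℝ) : ℂ) ^ 2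
    * τ)) * SS τ) (comap Complex.im atTop) (𝓝 1) := by
  have h := Th_tendsto1 PB_S
  have e : sg 0 * (((0 : ℤ) : ℂ) + 1 / 2) + sg (-1) * (((-1 : ℤ) : ℂ) + 1 / 2) = 1 := by
    norm_num [sg]
  rw [e] at h
  exact h

lemma lim_F : Tendsto (fun τ => SS τ / PP τ) (comap Complex.im atTop) (𝓝 (1 / 2)) := by
  refine (lim_S.div lim_P two_ne_zero).congr fun τ => ?_
  simp only [Pi.div_apply]
  rw [mul_div_mul_left _ _ (Complex.exp_ne_zero _)]

lemma pow_tendsto {τ : ℂ} (hτ : 0 < τ.im) :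
    Tendsto (fun n : ℕ => (2 : ℂ) ^ n * τ) atTop (comap Complex.im atTop) := by
  rw [tendsto_comap_iff]
  have e : (Complex.im ∘ fun n : ℕ => (2 : ℂ) ^ n * τ) = fun n : ℕ => (2 : ℝ) ^ n * τ.im := by
    funext n
    have : (2 : ℂ) ^ n = ((2 ^ n : ℝ) : ℂ) := by push_cast; rfl
    simp only [Function.comp]
    rw [this, Complex.im_ofReal_mul]
  rw [e]
  exact (tendsto_pow_atTop_atTop_of_one_lt (by norm_num)).atTop_mul_const hτ

lemma PP_ne {τ : ℂ} (hτ : 0 < τ.im) : PP τ ≠ 0 := by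
  have h1 : ∀ᶠ τ in comap Complex.im atTop, PP τ ≠ 0 := by
    filter_upwards [lim_P.eventually_ne two_ne_zero] with τ h h0
    exact h (by rw [h0, mul_zero])
  obtain ⟨n, hn⟩ := ((pow_tendsto hτ).eventually h1).exists
  clear h1
  induction n generalizing τ with
  | zero => simpa using hn
  | succ k ih =>
    refine PP_ne_of_two hτ (ih (two_im hτ) ?_)
    rwa [← mul_assoc, ← pow_succ]

lemma F_two {τ : ℂ} (hτ : 0 < τ.im) : SS (2 * τ) / PP (2 * τ) = SS τ / PP τ := by
  have h1 := PP_ne hτ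
  have h2 := PP_ne (two_im hτ)
  have h10 : theta10 τ ≠ 0 := fun h => h1 (by simp [PP, h])
  have h01 : theta01 (2 * τ) ≠ 0 := fun h => h2 (by simp [PP, h])
  rw [div_eq_div_iff h2 h1]
  have hS := dupS hτ
  have hP := dupP hτ
  apply mul_left_cancel₀ (mul_ne_zero (mul_ne_zero two_ne_zero h01) h10)
  linear_combination -theta10 τ * PP τ * hS + theta10 τ * SS τ * hP

lemma F_pow {τ : ℂ} (hτ : 0 < τ.im) (n : ℕ) :
    SS ((2 : ℂ) ^ n * τ) / PP ((2 : ℂ) ^ n * τ) = SS τ / PP τ := by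
  induction n generalizing τ with
  | zero => simp
  | succ k ih => rw [pow_succ, mul_assoc, ih (two_im hτ), F_two hτ]

/-- Jacobi's derivative formula. -/
lemma jacobi_deriv {τ : ℂ} (hτ : 0 < τ.im) : 2 * SS τ = PP τ := by
  have h := lim_F.comp (pow_tendsto hτ)
  have h' : Tendsto (fun _ : ℕ => SS τ / PP τ) atTop (𝓝 (1 / 2)) :=
    h.congr fun n => F_pow hτ n
  have e := tendsto_nhds_unique tendsto_const_nhds h'
  rw [div_eq_div_iff (PP_ne hτ) two_ne_zero] at e
  linear_combination e

lemma wronskian_final {τ : ℂ} (hτ : 0 < τ.im) :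
    4 * (D10 τ * theta00 τ - theta10 τ * D00 τ) = theta01 τ ^ 4 * theta00 τ * theta10 τ := by
  obtain ⟨σ, rfl⟩ : ∃ σ, τ = 2 * σ := ⟨τ / 2, by ring⟩
  have hσ : 0 < σ.im := by simpa using hτ
  have h1 := wronskian hσ
  have h2 := jacobi_deriv hσ
  have h3 := dup0001 hσ
  have h4 := dup10 hσ
  have h5 : PP σ ^ 2 = theta01 (2 * σ) ^ 4 * (2 * theta00 (2 * σ) * theta10 (2 * σ)) := by
    rw [← h4]; unfold PP; rw [h3]; ring
  rw [← h2] at h5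
  linear_combination -2 * h1 + h5 / 2

lemma deriv00 {τ : ℂ} (hτ : 0 < τ.im) :
    HasDerivAt theta00 ((Real.pi : ℂ) * Complex.I * D00 τ) τ := by
  have h := hasDerivAt_Th PB_one 0 hτ
  rw [← (funext theta00_eq_s11 : theta00 = Th (fun _ => 1) 0)] at h
  simpa [D00] using h

lemma deriv10 {τ : ℂ} (hτ : 0 < τ.im) :
    HasDerivAt theta10 ((Real.pi : ℂ) * Complex.I * D10 τ) τ := by
  have h := hasDerivAt_Th PB_one (1 / 2) hτ
  rw [← (funext theta10_eq_s11 : theta10 = Th (fun _ => 1) (1 / 2))] at h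
  simpa [D10] using h

/-- the derivative of Legendre's modular function
`λ = (θ₁₀/θ₀₀)⁴` satisfies `(1/πi) λ′ = λ θ₀₁⁴ = λ(1−λ) θ₀₀⁴`. -/
theorem legendre_lambda_derivative (τ : ℂ) (hτ : 0 < τ.im) :
    1 / ((Real.pi : ℂ) * Complex.I) * deriv (fun σ => (theta10 σ / theta00 σ) ^ 4) τ =
        (theta10 τ / theta00 τ) ^ 4 * theta01 τ ^ 4 ∧
    1 / ((Real.pi : ℂ) * Complex.I) * deriv (fun σ => (theta10 σ / theta00 σ) ^ 4) τ =
        (theta10 τ / theta00 τ) ^ 4 * (1 - (theta10 τ / theta00 τ) ^ 4) * theta00 τ ^ 4 := by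
  have h00 : theta00 τ ≠ 0 := fun h => PP_ne hτ (by simp [PP, h])
  have hd := (((deriv10 hτ).div (deriv00 hτ) h00).pow 4).deriv
  have hpi : (Real.pi : ℂ) * Complex.I ≠ 0 :=
    mul_ne_zero (by exact_mod_cast Real.pi_ne_zero) Complex.I_ne_zero
  have hw := wronskian_final hτ
  have hj := jacobi_id hτ
  have hd' : deriv (fun σ => (theta10 σ / theta00 σ) ^ 4) τ = _ := hd
  have h1 : 1 / ((Real.pi : ℂ) * Complex.I) * deriv (fun σ => (theta10 σ / theta00 σ) ^ 4) τ =
      (theta10 τ / theta00 τ) ^ 4 * theta01 τ ^ 4 := by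
    rw [hd']
    have : 1 / ((Real.pi : ℂ) * Complex.I) * ((4 : ℕ) * ((theta10 / theta00) τ) ^ (4 - 1) *
        (((Real.pi : ℂ) * Complex.I * D10 τ * theta00 τ -
          theta10 τ * ((Real.pi : ℂ) * Complex.I * D00 τ)) / theta00 τ ^ 2)) =
        (theta10 τ / theta00 τ) ^ 3 *
          ((4 * (D10 τ * theta00 τ - theta10 τ * D00 τ)) / theta00 τ ^ 2) := by
      simp only [Pi.div_apply]
      push_cast
      field_simp
    rw [this, hw]
    field_simp
  refine ⟨h1, ?_⟩
  rw [h1]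
  have : theta01 τ ^ 4 = (1 - (theta10 τ / theta00 τ) ^ 4) * theta00 τ ^ 4 := by
    field_simp
    linear_combination -hj
  rw [this]; ring
end
end
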